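/- Let G be the 7 × 7 real symmetric matrix with all diagonal entries equal to 1 and off-diagonal entries (symmetrically extended) G₁₂ = −1, G₁₃ = −(1/2 + 2√6/3), G₂₄ = −(1/2 + 2√6/3), G₁₄ = −1/2, G₂₃ = −1/2, G₃₄ = −1/2, G₃₅ = −1/2, G₄₇ = −1/2, G₅₆ = −1/2, G₆₇ = −1/2, G₅₇ = −1/2, and all other off-diagonal entries 0. Then G has exactly 4 positive eigenvalues (with multiplicity), exactly 1 negative eigenvalue, and exactly 2 zero eigenvalues; equivalently G has rank 5 and signature (4,1). -/

import Mathlib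

open Real

noncomputable def G7 : Matrix (Fin 7) (Fin 7) ℝ :=
  !![1, -1, -(1/2 + 2 * Real.sqrt 6 / 3), -(1/2), 0, 0, 0;
     -1, 1, -(1/2), -(1/2 + 2 * Real.sqrt 6 / 3), 0, 0, 0;
     -(1/2 + 2 * Real.sqrt 6 / 3), -(1/2), 1, -(1/2), -(1/2), 0, 0;
     -(1/2), -(1/2 + 2 * Real.sqrt 6 / 3), -(1/2), 1, 0, 0, -(1/2);
     0, 0, -(1/2), 0, 1, -(1/2), -(1/2);
     0, 0, 0, 0, -(1/2), 1, -(1/2);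
     0, 0, 0, -(1/2), -(1/2), -(1/2), 1]

open Matrix QuadraticMap QuadraticForm

theorem equivalent_weightedSumSquares_of_eq_transpose_mul_diagonal_mul {n : Type*} [Fintype n]
    [DecidableEq n] {A P : Matrix n n ℝ} {w : n → ℝ} (hP : IsUnit P)
    (hA : A = Pᵀ * diagonal w * P) :
    Equivalent A.toQuadraticForm' (weightedSumSquares ℝ w) := by
  have := hP.invertible
  refine ⟨⟨toLinearEquiv' P ‹_›, fun v => ?_⟩⟩
  have h₁ : (weightedSumSquares ℝ w) (P *ᵥ v) = (P *ᵥ v) ⬝ᵥ (diagonal w *ᵥ (P *ᵥ v)) := by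
    simp only [weightedSumSquares_apply, dotProduct, mulVec_diagonal, smul_eq_mul]
    exact Finset.sum_congr rfl fun i _ => by ring
  have h₂ : A.toQuadraticForm' v = v ⬝ᵥ (A *ᵥ v) := by
    simp [Matrix.toQuadraticForm', toLinearMap₂'_apply']
  change (weightedSumSquares ℝ w) (P *ᵥ v) = A.toQuadraticForm' v
  rw [h₁, h₂, hA, ← mulVec_mulVec, ← mulVec_mulVec, dotProduct_mulVec v, vecMul_transpose]

/-- Sylvester's law of inertia for real symmetric matrices: a congruence with a diagonal matrix
determines the signs of the eigenvalues. -/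
theorem Matrix.IsHermitian.card_eigenvalues_of_eq_transpose_mul_diagonal_mul {n : Type*}
    [Fintype n] [DecidableEq n] {A P : Matrix n n ℝ} {w : n → ℝ} (h : A.IsHermitian)
    (hP : IsUnit P) (hA : A = Pᵀ * diagonal w * P) :
    (Finset.univ.filter fun j => 0 < h.eigenvalues j).card =
        (Finset.univ.filter fun j => 0 < w j).card ∧
      (Finset.univ.filter fun j => h.eigenvalues j < 0).card =
        (Finset.univ.filter fun j => w j < 0).card := by
  let U : Matrix n n ℝ := h.eigenvectorUnitary
  have hU : IsUnit (star U) := (Unitary.isUnit_coe (U := star h.eigenvectorUnitary))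
  have hAU : A = (star U)ᵀ * diagonal h.eigenvalues * star U := by
    have := h.spectral_theorem
    rw [Unitary.conjStarAlgAut_apply] at this
    simpa [U, star_eq_conjTranspose] using this
  have e₁ := equivalent_weightedSumSquares_of_eq_transpose_mul_diagonal_mul hU hAU
  have e₂ := equivalent_weightedSumSquares_of_eq_transpose_mul_diagonal_mul hP hA
  constructor
  · have := (sigPos_of_equiv_weightedSumSquares e₁).symm.trans
      (sigPos_of_equiv_weightedSumSquares e₂)
    simpa [Set.ncard_eq_toFinset_card'] using this
  · have := (sigNeg_of_equiv_weightedSumSquares e₁).symm.trans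
      (sigNeg_of_equiv_weightedSumSquares e₂)
    simpa [Set.ncard_eq_toFinset_card'] using this

/-- The change of coordinates that diagonalizes `G7`. -/
noncomputable def G7Coord : Matrix (Fin 7) (Fin 7) ℝ :=
  !![1, -1, 0, 2 / 3 * √6, 0, 0, 0;
     0, 1, 0, 0, 0, 0, 0;
     -(1 / 2 + 2 / 3 * √6), -(1 / 2), 1, -(1 / 2), -(1 / 2), 0, 0;
     0, 0, 0, 1, 0, 0, 0;
     1 + 4 / 3 * √6, 1, 0, 3, 1, 0, 0;
     0, 0, 0, 0, -(1 / 2), 1, -(1 / 2);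
     0, 0, 0, -(2 / 3), -1, 0, 1]

/-- The diagonal entries of `G7` in the coordinates `G7Coord`. -/
noncomputable def G7Weights : Fin 7 → ℝ := ![1, 0, 1, 0, -(1 / 4), 1, 3 / 4]

theorem isUnit_G7Coord : IsUnit G7Coord := by
  rw [isUnit_iff_isUnit_det, isUnit_iff_ne_zero]
  intro hdet
  obtain ⟨v, hv, h⟩ := exists_mulVec_eq_zero_iff.mpr hdet
  apply hv
  simp only [G7Coord, funext_iff, Fin.forall_fin_succ, mulVec, dotProduct, Fin.sum_univ_succ] at h
  simp at h
  obtain ⟨h0, h1, h2, h3, h4, h5, h6⟩ := h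
  have v0 : v 0 = 0 := by simpa [h1, h3] using h0
  have v4 : v 4 = 0 := by simpa [v0, h1, h3] using h4
  have v6 : v 6 = 0 := by simpa [v4, h3] using h6
  have v5 : v 5 = 0 := by simpa [v4, v6] using h5
  have v2 : v 2 = 0 := by simpa [v0, v4, h1, h3] using h2
  ext i
  fin_cases i <;> assumption

theorem G7_eq_transpose_mul_diagonal_mul :
    G7 = G7Coordᵀ * diagonal G7Weights * G7Coord := by
  have h6 : √6 ^ 2 = (6 : ℝ) := Real.sq_sqrt (by norm_num)
  ext i j
  rw [mul_apply]
  simp only [mul_diagonal, transpose_apply]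
  fin_cases i <;> fin_cases j <;>
    simp [G7, G7Coord, G7Weights, Fin.sum_univ_succ] <;> ring_nf
  all_goals norm_num [h6]

theorem stmt_7 (hG : G7.IsHermitian) :
    (Finset.univ.filter fun j => 0 < hG.eigenvalues j).card = 4 ∧
    (Finset.univ.filter fun j => hG.eigenvalues j < 0).card = 1 ∧
    (Finset.univ.filter fun j => hG.eigenvalues j = 0).card = 2 ∧
    G7.rank = 5 := by
  have h := hG.card_eigenvalues_of_eq_transpose_mul_diagonal_mul isUnit_G7Coord
    G7_eq_transpose_mul_diagonal_mul
  have hpos : (Finset.univ.filter fun j => 0 < G7Weights j).card = 4 := by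
    rw [Finset.card_filter]
    norm_num [G7Weights, Fin.sum_univ_succ, -Finset.sum_boole]
  have hneg : (Finset.univ.filter fun j => G7Weights j < 0).card = 1 := by
    rw [Finset.card_filter]
    norm_num [G7Weights, Fin.sum_univ_succ, -Finset.sum_boole]
  rw [hpos, hneg] at h
  have hne : (Finset.univ.filter fun j => hG.eigenvalues j ≠ 0).card = 5 := by
    rw [show (5 : ℕ) = 4 + 1 from rfl, ← h.1, ← h.2, ← Finset.card_union_of_disjoint]
    · congr 1
      ext j
      simp [lt_or_lt_iff_ne, eq_comm]
    · exact Finset.disjoint_filter.mpr fun j _ h₁ h₂ => h₁.not_gt h₂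
  refine ⟨h.1, h.2, ?_, ?_⟩
  · have := Finset.card_filter_add_card_filter_not (s := Finset.univ)
      (fun j => hG.eigenvalues j = 0)
    rw [hne, Finset.card_univ, Fintype.card_fin] at this
    lia
  · rw [hG.rank_eq_card_non_zero_eigs, Fintype.card_subtype, hne]
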